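/- Let q ≥ 2, C ≥ 1, let k ≥ 1, and let ‖·‖_X be a 1-unconditional norm on ℝ^k that has cotype q with constant C. Then for every s > q the norm ‖·‖_X is s-concave with constant M := (1−e^{−1})^{−2} · s · (2q(s−1)/(s−q))^{1−1/s} · C; that is, for all m and all x_1,…,x_m ∈ ℝ^k, ‖(∑_{i=1}^m |x_i|^s)^{1/s}‖_X ≥ (1/M)·(∑_{i=1}^m ‖x_i‖_X^s)^{1/s}, where (∑_{i=1}^m |x_i|^s)^{1/s} denotes the vector in ℝ^k whose j-th coordinate is (∑_{i=1}^m |(x_i)_j|^s)^{1/s}. -/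

import Mathlib

open Finset

attribute [local instance] Classical.propDecidable

noncomputable section

/-- Distance (in `ℕ∞`) from a vertex to a finite set of vertices. -/
def vertexSetDist {n : ℕ} (G : SimpleGraph (Fin n)) (v : Fin n) (S : Finset (Fin n)) : ℕ∞ :=
  S.inf fun w => G.edist v w

/-- Distance (in `ℕ∞`) from a vertex to an (unordered) edge. -/
def edgeDist {n : ℕ} (G : SimpleGraph (Fin n)) (v : Fin n) (e : Sym2 (Fin n)) : ℕ∞ :=
  Sym2.lift ⟨fun a b => min (G.edist v a) (G.edist v b), fun _ _ => min_comm _ _⟩ e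

/-- Distance (in `ℕ∞`) from an (unordered) edge to a finite set of vertices. -/
def edgeSetDist {n : ℕ} (G : SimpleGraph (Fin n)) (e : Sym2 (Fin n)) (S : Finset (Fin n)) : ℕ∞ :=
  S.inf fun v => edgeDist G v e

/-- Part (A) of the long-range expansion property. -/
def ExpanA (n d : ℕ) (G : SimpleGraph (Fin n)) (α : ℝ) : Prop :=
  ∀ S : Finset (Fin n), S.Nonempty → ∀ ℓ : ℕ, 1 ≤ ℓ →
    min (3 * (n : ℝ) / 4) (α * ((d : ℝ) - 1) ^ ℓ * S.card) ≤
      ((univ.filter fun v => vertexSetDist G v S ≤ (ℓ : ℕ∞)).card : ℝ)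

/-- Part (B) of the long-range expansion property. -/
def ExpanB (n d : ℕ) (G : SimpleGraph (Fin n)) [DecidableRel G.Adj] (α ε L : ℝ) : Prop :=
  ∀ S : Finset (Fin n), S.Nonempty → ∀ ℓ : ℕ, 1 ≤ ℓ →
    α * ((d : ℝ) - 1) ^ (ℓ - 1) * S.card ≤ 3 * n / 4 →
    ∃ v ∈ S,
      (((G.edgeFinset.filter fun e =>
            L * ((d : ℝ) - 1 - ε) ^ ℓ ≤
              ((S.filter fun u => edgeDist G u e ≤ ((ℓ - 1 : ℕ) : ℕ∞)).card : ℝ)).filter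
          fun e => edgeDist G v e ≤ ((ℓ - 1 : ℕ) : ℕ∞)).card : ℝ) ≤
        L * ((d : ℝ) - 1 - ε) ^ ℓ

/-- The long-range expansion property `Expan(α, ε, L)`. -/
def Expan (n d : ℕ) (G : SimpleGraph (Fin n)) [DecidableRel G.Adj] (α ε L : ℝ) : Prop :=
  ExpanA n d G α ∧ ExpanB n d G α ε L

/-- `N` is a norm on `ℝ^k`. -/
def IsNorm (k : ℕ) (N : (Fin k → ℝ) → ℝ) : Prop :=
  (∀ x, N x = 0 ↔ x = 0) ∧ (∀ (c : ℝ) (x), N (c • x) = |c| * N x) ∧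
    ∀ x y, N (x + y) ≤ N x + N y

/-- The standard basis of `ℝ^k` is `K`-unconditional for `N`. -/
def UncondConst (k : ℕ) (N : (Fin k → ℝ) → ℝ) (K : ℝ) : Prop :=
  ∀ (σ : Fin k → Bool) (a : Fin k → ℝ),
    N (fun j => (if σ j then (1 : ℝ) else -1) * a j) ≤ K * N a

/-- `N` is a `1`-unconditional norm on `ℝ^k`: `‖y‖ = ‖|y|‖`. -/
def OneUnconditional (k : ℕ) (N : (Fin k → ℝ) → ℝ) : Prop :=
  ∀ y, N y = N fun j => |y j|

/-- `N` has cotype `q` with constant `C`. -/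
def HasCotype (k : ℕ) (N : (Fin k → ℝ) → ℝ) (q C : ℝ) : Prop :=
  ∀ (m : ℕ) (x : Fin m → Fin k → ℝ),
    1 / C ^ q * ∑ i, N (x i) ^ q ≤
      1 / 2 ^ m * ∑ σ : Fin m → Bool, N (∑ i, (if σ i then (1 : ℝ) else -1) • x i) ^ q

/-- The collection of vectors `Y` has restricted cotype `q` with constant `C` w.r.t. `N`. -/
def RestrictedCotype (k : ℕ) (N : (Fin k → ℝ) → ℝ) (q C : ℝ) (Y : Set (Fin k → ℝ)) : Prop :=
  ∀ (m : ℕ), 0 < m → ∀ y : Fin m → Fin k → ℝ, Function.Injective y → (∀ i, y i ∈ Y) →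
    1 / C ^ q * ∑ i, N (y i) ^ q ≤
      1 / 2 ^ m * ∑ σ : Fin m → Bool, N (∑ i, (if σ i then (1 : ℝ) else -1) • y i) ^ q

/-- For an edge `e = {a, b}`, the value `N (f a - f b)` (well-defined when `N` is a norm). -/
def edgeNorm {n k : ℕ} (N : (Fin k → ℝ) → ℝ) (f : Fin n → Fin k → ℝ) (e : Sym2 (Fin n)) : ℝ :=
  Sym2.lift ⟨fun a b => min (N (f a - f b)) (N (f b - f a)), fun _ _ => min_comm _ _⟩ e

/-- Coordinate projection `P_J`. -/
def proj {k : ℕ} (J : Finset (Fin k)) (y : Fin k → ℝ) : Fin k → ℝ :=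
  fun j => if j ∈ J then y j else 0

/-- Indicator vector `χ_J ∈ ℝ^k`. -/
def chi {k : ℕ} (J : Finset (Fin k)) : Fin k → ℝ := fun j => if j ∈ J then 1 else 0

/-- The sequence `a_ℓ = (6/π²) ℓ⁻²`. -/
def aseq (ℓ : ℕ) : ℝ := 6 / Real.pi ^ 2 * (1 / (ℓ : ℝ) ^ 2)

/-- The set of edges `E(S, j; ℓ)`: edges within distance `ℓ - 1` of `S` with a jump in the
`j`-th coordinate. -/
def jumpEdges {n k : ℕ} (G : SimpleGraph (Fin n)) [DecidableRel G.Adj]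
    (f : Fin n → Fin k → ℝ) (j : Fin k) (S : Finset (Fin n)) (ℓ : ℕ) :
    Finset (Sym2 (Fin n)) :=
  G.edgeFinset.filter fun e =>
    edgeSetDist G e S ≤ ((ℓ - 1 : ℕ) : ℕ∞) ∧
      Sym2.lift ⟨fun a b => f a j ≠ f b j, fun _ _ => propext ne_comm⟩ e

/-- The scale `ℓ_{v,j}`. -/
def lvj {n k : ℕ} (G : SimpleGraph (Fin n)) [DecidableRel G.Adj]
    (f : Fin n → Fin k → ℝ) (α : ℝ) (d : ℕ) (v : Fin n) (j : Fin k) : ℕ :=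
  sInf {ℓ : ℕ | 1 ≤ ℓ ∧
    α * aseq ℓ / 6 * ((d : ℝ) - 1) ^ (ℓ - 1) ≤ ((jumpEdges G f j {v} ℓ).card : ℝ)}

/-- The set `V_+(j; ℓ)`. -/
def Vplus {n k : ℕ} (G : SimpleGraph (Fin n)) [DecidableRel G.Adj]
    (f : Fin n → Fin k → ℝ) (α : ℝ) (d : ℕ) (j : Fin k) (ℓ : ℕ) : Finset (Fin n) :=
  univ.filter fun v => f v j = 1 ∧ lvj G f α d v j = ℓ

/-- The set `V_-(j; ℓ)`. -/
def Vminus {n k : ℕ} (G : SimpleGraph (Fin n)) [DecidableRel G.Adj]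
    (f : Fin n → Fin k → ℝ) (α : ℝ) (d : ℕ) (j : Fin k) (ℓ : ℕ) : Finset (Fin n) :=
  univ.filter fun v => f v j = -1 ∧ lvj G f α d v j = ℓ

/-- The scale-`ℓ` support `J(v, ℓ)`. -/
def Jset {n k : ℕ} (G : SimpleGraph (Fin n)) [DecidableRel G.Adj]
    (f : Fin n → Fin k → ℝ) (α : ℝ) (d : ℕ) (v : Fin n) (ℓ : ℕ) : Finset (Fin k) :=
  univ.filter fun j => f v j ≠ 0 ∧ lvj G f α d v j = ℓ

/-- The scale-`ℓ` mutual support `J(v, ℓ, e)`, relative to a family `Ẽ(v, j)` of edge sets. -/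
def JsetE {n k : ℕ} (G : SimpleGraph (Fin n)) [DecidableRel G.Adj]
    (f : Fin n → Fin k → ℝ) (α : ℝ) (d : ℕ) (Et : Fin n → Fin k → Finset (Sym2 (Fin n)))
    (v : Fin n) (ℓ : ℕ) (e : Sym2 (Fin n)) : Finset (Fin k) :=
  (Jset G f α d v ℓ).filter fun j => e ∈ Et v j

end

lemma aux_nonneg {k : ℕ} {N : (Fin k → ℝ) → ℝ} (hN : IsNorm k N) (x : Fin k → ℝ) : 0 ≤ N x := by
  have h0 : N 0 = 0 := (hN.1 0).2 rfl
  have h1 := hN.2.2 x ((-1 : ℝ) • x)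
  rw [hN.2.1] at h1
  have h2 : x + (-1 : ℝ) • x = 0 := by simp
  rw [h2, h0] at h1
  norm_num at h1
  linarith

lemma aux_functional {k : ℕ} {N : (Fin k → ℝ) → ℝ} (hN : IsNorm k N) (hunc : OneUnconditional k N)
    (x : Fin k → ℝ) : ∃ φ : Fin k → ℝ, (∀ j, 0 ≤ φ j) ∧ N x ≤ ∑ j, φ j * |x j| ∧
      ∀ y, ∑ j, φ j * |y j| ≤ N y := by
  by_cases hx : x = 0
  · refine ⟨0, by simp, ?_, ?_⟩
    · rw [(hN.1 x).2 hx]; simp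
    · intro y; simpa using aux_nonneg hN y
  obtain ⟨g, hg1, hg2⟩ := exists_extension_of_le_sublinear
    (LinearPMap.mkSpanSingleton x (N x) hx) N
    (fun c hc y => by rw [hN.2.1, abs_of_pos hc]) hN.2.2 (by
      rintro ⟨y, hy⟩
      obtain ⟨c, rfl⟩ := Submodule.mem_span_singleton.1 hy
      rw [LinearPMap.mkSpanSingleton'_apply]
      change c • N x ≤ N (c • x)
      rw [hN.2.1, smul_eq_mul]
      exact mul_le_mul_of_nonneg_right (le_abs_self c) (aux_nonneg hN x))
  have hgx : g x = N x := by
    have := hg1 ⟨x, Submodule.mem_span_singleton_self x⟩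
    exact this.trans (LinearPMap.mkSpanSingleton'_apply_self _ _ _ _)
  have hsum : ∀ y, g y = ∑ j, g (Pi.single j 1) * y j := by
    intro y
    rw [LinearMap.pi_apply_eq_sum_univ g y]
    refine Finset.sum_congr rfl fun j _ => ?_
    rw [smul_eq_mul, mul_comm]
    congr 2
    ext i
    simp [Pi.single_apply, eq_comm]
  refine ⟨fun j => |g (Pi.single j 1)|, fun j => abs_nonneg _, ?_, ?_⟩
  · rw [← hgx, hsum]
    refine Finset.sum_le_sum fun j _ => ?_
    rw [← abs_mul]; exact le_abs_self _
  · intro y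
    let y' : Fin k → ℝ := fun j => if 0 ≤ g (Pi.single j 1) then |y j| else -|y j|
    have h1 : N y' = N y := by
      rw [hunc y', hunc y]
      congr 1
      ext j
      simp only [y']
      split_ifs <;> simp
    rw [← h1]
    refine le_trans (le_of_eq ?_) (hg2 y')
    rw [hsum]
    refine Finset.sum_congr rfl fun j _ => ?_
    simp only [y']
    split_ifs with h
    · rw [abs_of_nonneg h]
    · rw [abs_of_neg (not_le.1 h)]; ring

lemma aux_mono {k : ℕ} {N : (Fin k → ℝ) → ℝ} (hN : IsNorm k N) (hunc : OneUnconditional k N)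
    (x y : Fin k → ℝ) (h : ∀ j, |x j| ≤ |y j|) : N x ≤ N y := by
  obtain ⟨φ, h0, h1, h2⟩ := aux_functional hN hunc x
  exact h1.trans (le_trans
    (Finset.sum_le_sum fun j _ => mul_le_mul_of_nonneg_left (h j) (h0 j)) (h2 y))

lemma aux_lower {k m : ℕ} {N : (Fin k → ℝ) → ℝ} (hN : IsNorm k N) (hunc : OneUnconditional k N)
    {q C : ℝ} (hq : 2 ≤ q) (hC : 1 ≤ C) (hcot : HasCotype k N q C) (z : Fin k → ℝ)
    (idx : Fin k → Option (Fin m)) :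
    ∑ i, N (fun j => if idx j = some i then z j else 0) ^ q ≤ (C * N z) ^ q := by
  have h := hcot m (fun i j => if idx j = some i then z j else 0)
  have hCq : 0 < C ^ q := Real.rpow_pos_of_pos (by linarith) q
  have h2 : ∑ σ : Fin m → Bool, N (∑ i, (if σ i then (1 : ℝ) else -1) •
      (fun j => if idx j = some i then z j else 0)) ^ q ≤ ∑ σ : Fin m → Bool, N z ^ q := by
    refine Finset.sum_le_sum fun σ _ => ?_
    refine Real.rpow_le_rpow (aux_nonneg hN _) (aux_mono hN hunc _ _ fun j => ?_) (by linarith)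
    rw [Finset.sum_apply]
    simp only [Pi.smul_apply, smul_eq_mul]
    rcases hj : idx j with _ | i0
    · simp
    · rw [Finset.sum_eq_single i0]
      · split_ifs <;> simp
      · intro b _ hb
        have hne : ¬ (some i0 = some b) := fun h => hb (Option.some.inj h).symm
        rw [if_neg hne, mul_zero]
      · simp
  have h3 : 1 / 2 ^ m * ∑ σ : Fin m → Bool, N z ^ q = N z ^ q := by
    simp
  have h4 := h.trans ((mul_le_mul_of_nonneg_left h2 (by positivity)).trans h3.le)
  rw [Real.mul_rpow (by linarith) (aux_nonneg hN z)]
  rw [one_div, inv_mul_le_iff₀ hCq] at h4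
  exact h4

noncomputable def auxh (T p r c u : ℝ) : ℝ :=
  if u ≤ (c / T) ^ p then c * u ^ (-1 / p) else T / r * (c / T) ^ r * u ^ (-r / p)

lemma auxh_int {T p r c : ℝ} (hT : 0 < T) (hp : 1 < p) (hr : p < r) (hc : 0 ≤ c) (hcT : c ≤ T) :
    MeasureTheory.IntegrableOn (auxh T p r c) (Set.Ioc 0 1) ∧
    ∫ u in Set.Ioc (0:ℝ) 1, auxh T p r c u ≤
      T * (c / T) ^ p * (p / (p - 1) + p / (r - p) / r) := by
  rcases hc.eq_or_lt with rfl | hc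
  · have : auxh T p r 0 = fun _ => 0 := by
      ext u
      unfold auxh
      simp [Real.zero_rpow (by linarith : r ≠ 0)]
    rw [this]
    simp [Real.zero_rpow (by linarith : p ≠ 0)]
  set e := c / T with he
  have he0 : 0 < e := div_pos hc hT
  have he1 : e ≤ 1 := (div_le_one hT).2 hcT
  have hce : c = T * e := by rw [he]; field_simp
  set α := e ^ p with hα
  have hα0 : 0 < α := Real.rpow_pos_of_pos he0 _
  have hα1 : α ≤ 1 := Real.rpow_le_one he0.le he1 (by linarith)
  have hp0 : 0 < p := by linarith
  have hr0 : 0 < r := by linarith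
  have hexp : -1 < -1 / p := by rw [lt_div_iff₀ hp0]; linarith
  have hexp2 : -r / p < -1 := by rw [div_lt_iff₀ hp0]; linarith
  have hnot : (0:ℝ) ∉ Set.uIcc α 1 := by
    rw [Set.uIcc_of_le hα1]; intro h; exact absurd h.1 (not_le.2 hα0)
  have e1 : Set.EqOn (fun u => c * u ^ (-1 / p)) (auxh T p r c) (Set.Ioc 0 α) := by
    intro u hu
    unfold auxh
    rw [if_pos hu.2]
  have e2 : Set.EqOn (fun u => T / r * e ^ r * u ^ (-r / p)) (auxh T p r c) (Set.Ioc α 1) := by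
    intro u hu
    unfold auxh
    rw [if_neg (not_le.2 hu.1)]
  have i1 : IntervalIntegrable (fun u : ℝ => c * u ^ (-1 / p)) MeasureTheory.volume 0 α :=
    (intervalIntegral.intervalIntegrable_rpow' hexp).const_mul c
  have i2 : IntervalIntegrable (fun u : ℝ => T / r * e ^ r * u ^ (-r / p))
      MeasureTheory.volume α 1 :=
    (intervalIntegral.intervalIntegrable_rpow (Or.inr hnot)).const_mul _
  rw [intervalIntegrable_iff_integrableOn_Ioc_of_le hα0.le] at i1
  rw [intervalIntegrable_iff_integrableOn_Ioc_of_le hα1] at i2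
  have j1 := i1.congr_fun e1 measurableSet_Ioc
  have j2 := i2.congr_fun e2 measurableSet_Ioc
  have hU : Set.Ioc (0:ℝ) 1 = Set.Ioc 0 α ∪ Set.Ioc α 1 := (Set.Ioc_union_Ioc_eq_Ioc hα0.le hα1).symm
  refine ⟨by rw [hU]; exact j1.union j2, ?_⟩
  rw [hU, MeasureTheory.setIntegral_union (Set.Ioc_disjoint_Ioc_of_le le_rfl) measurableSet_Ioc j1 j2]
  rw [← MeasureTheory.setIntegral_congr_fun measurableSet_Ioc e1,
    ← MeasureTheory.setIntegral_congr_fun measurableSet_Ioc e2,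
    ← intervalIntegral.integral_of_le hα0.le, ← intervalIntegral.integral_of_le hα1,
    intervalIntegral.integral_const_mul, intervalIntegral.integral_const_mul,
    integral_rpow (Or.inl hexp), integral_rpow (Or.inr ⟨hexp2.ne, hnot⟩)]
  have a1 : α ^ (-1 / p + 1) = e ^ p / e := by
    rw [hα, ← Real.rpow_mul he0.le, show p * (-1 / p + 1) = p - 1 by field_simp; ring,
      Real.rpow_sub_one he0.ne']
  have a2 : α ^ (-r / p + 1) = e ^ p / e ^ r := by
    rw [hα, ← Real.rpow_mul he0.le, show p * (-r / p + 1) = p - r by field_simp; ring,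
      Real.rpow_sub he0]
  rw [a1, a2, Real.zero_rpow (by linarith), Real.one_rpow, mul_add]
  have er : 0 < e ^ r := Real.rpow_pos_of_pos he0 _
  have hp1 : 0 < p - 1 := by linarith
  have hrp : 0 < r - p := by linarith
  refine add_le_add (le_of_eq ?_) ?_
  · rw [hce, show -1 / p + 1 = (p - 1) / p by field_simp; ring]
    field_simp
    rw [mul_zero, sub_zero]
  · rw [show -r / p + 1 = -((r - p) / p) by field_simp; ring]
    rw [div_neg, ← neg_div, neg_sub]
    have : T / r * e ^ r * ((e ^ p / e ^ r - 1) / ((r - p) / p)) =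
        T * (e ^ p - e ^ r) * (p / (r - p) / r) := by
      field_simp
    rw [this]
    gcongr
    linarith

lemma aux_point {k m : ℕ} {N : (Fin k → ℝ) → ℝ} (hN : IsNorm k N) (hunc : OneUnconditional k N)
    {q C : ℝ} (hq : 2 ≤ q) (hC : 1 ≤ C) (hcot : HasCotype k N q C) (z : Fin k → ℝ)
    (hz : ∀ j, 0 ≤ z j) (hNz : 0 < N z) {p r T : ℝ} (hp : 1 < p) (hrq : r.HolderConjugate q)
    (hT : 0 < T) (c : Fin m → ℝ) (hc : ∀ i, 0 ≤ c i) (φ : Fin m → Fin k → ℝ)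
    (hφ : ∀ i j, 0 ≤ φ i j) (hφN : ∀ i y, ∑ j, φ i j * |y j| ≤ N y)
    (w : Fin k → ℝ) (hw : ∀ j, 0 ≤ w j) (U : Fin m → ℝ) (hU : ∀ i, 0 < U i) :
    ∑ j, (if ∃ i, U i ≤ (c i * φ i j / w j) ^ p then z j * w j else 0) ≤
      (C * N z) * (T / q + ∑ i, auxh T p r (c i) (U i)) := by
  have hp0 : 0 < p := by linarith
  set D := C * N z with hD
  have hD0 : 0 < D := mul_pos (by linarith) hNz
  have hzD : N z ≤ D := by nlinarith
  let idx : Fin k → Option (Fin m) := fun j =>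
    if h : ∃ i, U i ≤ (c i * φ i j / w j) ^ p then some h.choose else none
  let V : Fin m → Fin k → ℝ := fun i j => if idx j = some i then z j else 0
  have hVz : ∀ i, N (V i) ≤ N z := by
    intro i
    refine aux_mono hN hunc _ _ fun j => ?_
    simp only [V]
    split_ifs
    · exact le_rfl
    · simp
  have hVn : ∀ i j, 0 ≤ V i j := by
    intro i j
    simp only [V]
    split_ifs
    · exact hz j
    · exact le_rfl
  have hlow : ∑ i, N (V i) ^ q ≤ D ^ q := aux_lower hN hunc hq hC hcot z idx
  set θ : Fin m → ℝ := fun i => U i ^ (-1 / p) with hθ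
  have hθ0 : ∀ i, 0 ≤ θ i := fun i => Real.rpow_nonneg (hU i).le _
  have s1 : ∑ j, (if ∃ i, U i ≤ (c i * φ i j / w j) ^ p then z j * w j else 0) ≤
      ∑ j, ∑ i, c i * θ i * (φ i j * |V i j|) := by
    refine Finset.sum_le_sum fun j _ => ?_
    have hterm : ∀ i, 0 ≤ c i * θ i * (φ i j * |V i j|) := fun i =>
      mul_nonneg (mul_nonneg (hc i) (hθ0 i)) (mul_nonneg (hφ i j) (abs_nonneg _))
    split_ifs with h
    · have hi := h.choose_spec
      have hidx : idx j = some h.choose := by simp only [idx]; rw [dif_pos h]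
      generalize h.choose = i0 at hi hidx
      refine le_trans ?_ (Finset.single_le_sum (fun i _ => hterm i) (Finset.mem_univ i0))
      have hV : V i0 j = z j := by simp only [V]; rw [if_pos hidx]
      rw [hV, abs_of_nonneg (hz j)]
      have ha0 : 0 ≤ c i0 * φ i0 j / w j := div_nonneg (mul_nonneg (hc _) (hφ _ _)) (hw j)
      have hw0 : 0 < w j := by
        refine (hw j).lt_of_ne fun h0 => ?_
        rw [← h0, div_zero, Real.zero_rpow hp0.ne'] at hi
        exact absurd (hU i0) (not_lt.2 hi)
      have h1 : U i0 ^ (1 / p) ≤ c i0 * φ i0 j / w j := by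
        have := Real.rpow_le_rpow (hU i0).le hi (by positivity : 0 ≤ 1 / p)
        rwa [← Real.rpow_mul ha0, mul_one_div_cancel hp0.ne', Real.rpow_one] at this
      have h2 : θ i0 = (U i0 ^ (1 / p))⁻¹ := by
        simp only [hθ]
        rw [← Real.rpow_neg (hU i0).le, neg_div]
      have h3 : 0 < U i0 ^ (1 / p) := Real.rpow_pos_of_pos (hU i0) _
      have h4 : w j ≤ c i0 * φ i0 j * θ i0 := by
        rw [h2, ← div_eq_mul_inv, le_div_iff₀ h3]
        rw [le_div_iff₀ hw0] at h1
        linarith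
      calc z j * w j ≤ z j * (c i0 * φ i0 j * θ i0) := mul_le_mul_of_nonneg_left h4 (hz j)
        _ = _ := by ring
    · exact Finset.sum_nonneg fun i _ => hterm i
  have s2 : ∑ j, ∑ i, c i * θ i * (φ i j * |V i j|) ≤ ∑ i, c i * θ i * N (V i) := by
    rw [Finset.sum_comm]
    refine Finset.sum_le_sum fun i _ => ?_
    rw [← Finset.mul_sum]
    exact mul_le_mul_of_nonneg_left (hφN i (V i)) (mul_nonneg (hc i) (hθ0 i))
  have hq0 : 0 < q := by linarith
  have s3 : ∀ i, c i * θ i * N (V i) ≤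
      D * auxh T p r (c i) (U i) + D * (T / q) * (N (V i) ^ q / D ^ q) := by
    intro i
    have hnn : 0 ≤ D * (T / q) * (N (V i) ^ q / D ^ q) := by
      have := Real.rpow_nonneg (aux_nonneg hN (V i)) q
      positivity
    unfold auxh
    split_ifs with h
    · have : c i * θ i * N (V i) ≤ c i * θ i * D :=
        mul_le_mul_of_nonneg_left ((hVz i).trans hzD) (mul_nonneg (hc i) (hθ0 i))
      simp only [hθ] at this ⊢
      linarith
    · have hy := Real.young_inequality_of_nonneg
        (div_nonneg (mul_nonneg (hc i) (hθ0 i)) hT.le)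
        (div_nonneg (aux_nonneg hN (V i)) hD0.le) hrq
      rw [Real.div_rpow (aux_nonneg hN (V i)) hD0.le, mul_div_right_comm,
        Real.mul_rpow (div_nonneg (hc i) hT.le) (hθ0 i)] at hy
      have e : θ i ^ r = U i ^ (-r / p) := by
        simp only [hθ]
        rw [← Real.rpow_mul (hU i).le]
        congr 1
        ring
      rw [e] at hy
      have := mul_le_mul_of_nonneg_left hy (mul_pos hT hD0).le
      calc c i * θ i * N (V i) = T * D * (c i / T * θ i * (N (V i) / D)) := by field_simp
        _ ≤ _ := this
        _ = _ := by ring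
  calc _ ≤ _ := s1.trans s2
    _ ≤ ∑ i, (D * auxh T p r (c i) (U i) + D * (T / q) * (N (V i) ^ q / D ^ q)) :=
      Finset.sum_le_sum fun i _ => s3 i
    _ = D * ∑ i, auxh T p r (c i) (U i) + D * (T / q) * ((∑ i, N (V i) ^ q) / D ^ q) := by
      rw [Finset.sum_add_distrib, ← Finset.mul_sum, ← Finset.mul_sum, ← Finset.sum_div]
    _ ≤ D * ∑ i, auxh T p r (c i) (U i) + D * (T / q) * 1 := by
      gcongr
      exact (div_le_one (Real.rpow_pos_of_pos hD0 _)).2 hlow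
    _ = _ := by ring

lemma aux_prob : MeasureTheory.IsProbabilityMeasure
    ((MeasureTheory.volume : MeasureTheory.Measure ℝ).restrict (Set.Ioc 0 1)) :=
  ⟨by simp⟩

lemma aux_event {m : ℕ} (a : Fin m → ℝ) (ha : ∀ i, 0 ≤ a i) (hsum : ∑ i, a i = 1) :
    MeasurableSet {U : Fin m → ℝ | ∃ i, U i ≤ a i} ∧
    1 - Real.exp (-1) ≤ (MeasureTheory.Measure.pi (fun _ : Fin m =>
      (MeasureTheory.volume : MeasureTheory.Measure ℝ).restrict (Set.Ioc 0 1))).real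
      {U : Fin m → ℝ | ∃ i, U i ≤ a i} := by
  have := aux_prob
  have hms : MeasurableSet {U : Fin m → ℝ | ∃ i, U i ≤ a i} := by
    rw [Set.ofPred_exists]
    exact MeasurableSet.iUnion fun i => measurableSet_le (measurable_pi_apply i) measurable_const
  refine ⟨hms, ?_⟩
  have hcompl : {U : Fin m → ℝ | ∃ i, U i ≤ a i}ᶜ = Set.univ.pi fun i => Set.Ioi (a i) := by
    ext U
    simp
  have h1 := MeasureTheory.probReal_compl_eq_one_sub (μ := MeasureTheory.Measure.pi (fun _ : Fin m =>
      (MeasureTheory.volume : MeasureTheory.Measure ℝ).restrict (Set.Ioc 0 1))) hms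
  rw [hcompl] at h1
  have h2 : (MeasureTheory.Measure.pi (fun _ : Fin m =>
      (MeasureTheory.volume : MeasureTheory.Measure ℝ).restrict (Set.Ioc 0 1))).real
      (Set.univ.pi fun i => Set.Ioi (a i)) ≤ Real.exp (-1) := by
    rw [MeasureTheory.measureReal_def, MeasureTheory.Measure.pi_pi, ENNReal.toReal_prod]
    rw [show (-1 : ℝ) = -∑ i, a i by rw [hsum],
      ← Finset.sum_neg_distrib, Real.exp_sum]
    refine Finset.prod_le_prod (fun i _ => ENNReal.toReal_nonneg) fun i _ => ?_
    have hai : a i ≤ 1 := hsum ▸ Finset.single_le_sum (fun i _ => ha i) (Finset.mem_univ i)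
    rw [MeasureTheory.Measure.restrict_apply measurableSet_Ioi]
    have : Set.Ioi (a i) ∩ Set.Ioc 0 1 = Set.Ioc (a i) 1 := by
      ext u
      simp only [Set.mem_inter_iff, Set.mem_Ioi, Set.mem_Ioc]
      constructor
      · rintro ⟨h1, h2, h3⟩; exact ⟨h1, h3⟩
      · rintro ⟨h1, h2⟩; exact ⟨h1, (ha i).trans_lt h1, h2⟩
    rw [this, Real.volume_Ioc, ENNReal.toReal_ofReal (by linarith)]
    have := Real.add_one_le_exp (-a i)
    linarith
  linarith

lemma aux_core {k m : ℕ} {N : (Fin k → ℝ) → ℝ} (hN : IsNorm k N) (hunc : OneUnconditional k N)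
    {q C : ℝ} (hq : 2 ≤ q) (hC : 1 ≤ C) (hcot : HasCotype k N q C) (z : Fin k → ℝ)
    (hz : ∀ j, 0 ≤ z j) (hNz : 0 < N z) {p r T : ℝ} (hp : 1 < p) (hpr : p < r)
    (hrq : r.HolderConjugate q)
    (hT : 1 ≤ T) (c : Fin m → ℝ) (hc : ∀ i, 0 ≤ c i) (hcs : ∑ i, c i ^ p ≤ 1)
    (φ : Fin m → Fin k → ℝ)
    (hφ : ∀ i j, 0 ≤ φ i j) (hφN : ∀ i y, ∑ j, φ i j * |y j| ≤ N y) :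
    (1 - Real.exp (-1)) * ∑ j, z j * (∑ i, (c i * φ i j) ^ p) ^ (1 / p) ≤
      (C * N z) * (T / q + T * (1 / T ^ p) * (p / (p - 1) + p / (r - p) / r)) := by
  have hprob := aux_prob
  have hp0 : 0 < p := by linarith
  have hT0 : 0 < T := by linarith
  have hcφ : ∀ i j, 0 ≤ (c i * φ i j) ^ p :=
    fun i j => Real.rpow_nonneg (mul_nonneg (hc i) (hφ i j)) _
  set w : Fin k → ℝ := fun j => (∑ i, (c i * φ i j) ^ p) ^ (1 / p) with hw
  have hw0 : ∀ j, 0 ≤ w j := fun j => Real.rpow_nonneg (Finset.sum_nonneg fun i _ => hcφ i j) _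
  set μ := MeasureTheory.Measure.pi (fun _ : Fin m =>
      (MeasureTheory.volume : MeasureTheory.Measure ℝ).restrict (Set.Ioc 0 1)) with hμ
  let E : Fin k → Set (Fin m → ℝ) := fun j => {U | ∃ i, U i ≤ (c i * φ i j / w j) ^ p}
  have hEm : ∀ j, MeasurableSet (E j) := by
    intro j
    simp only [E]
    rw [Set.ofPred_exists]
    exact MeasurableSet.iUnion fun i => measurableSet_le (measurable_pi_apply i) measurable_const
  have hE : ∀ j, (1 - Real.exp (-1)) * (z j * w j) ≤ μ.real (E j) * (z j * w j) := by
    intro j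
    rcases (hw0 j).eq_or_lt with h0 | h0
    · rw [← h0]; simp
    · refine mul_le_mul_of_nonneg_right ?_ (mul_nonneg (hz j) (hw0 j))
      refine (aux_event (fun i => (c i * φ i j / w j) ^ p) (fun i => ?_) ?_).2
      · exact Real.rpow_nonneg (div_nonneg (mul_nonneg (hc i) (hφ i j)) (hw0 j)) _
      · have : w j ^ p = ∑ i, (c i * φ i j) ^ p := by
          simp only [hw]
          rw [← Real.rpow_mul (Finset.sum_nonneg fun i _ => hcφ i j),
            one_div_mul_cancel hp0.ne', Real.rpow_one]
        simp_rw [fun i => Real.div_rpow (mul_nonneg (hc i) (hφ i j)) (hw0 j) p]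
        rw [← Finset.sum_div, this, div_self]
        rw [← this]
        exact (Real.rpow_pos_of_pos h0 _).ne'
  have hc1 : ∀ i, c i ≤ T := by
    intro i
    refine le_trans ?_ hT
    have h1 : c i ^ p ≤ 1 := le_trans (Finset.single_le_sum
      (f := fun i => c i ^ p) (fun i _ => Real.rpow_nonneg (hc i) _) (Finset.mem_univ i)) hcs
    by_contra h
    exact absurd h1 (not_le.2 (Real.one_lt_rpow (not_le.1 h) hp0))
  have hint : ∀ i, MeasureTheory.Integrable (fun U : Fin m → ℝ => auxh T p r (c i) (U i)) μ :=
    fun i => MeasureTheory.integrable_comp_eval (μ := fun _ : Fin m =>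
      (MeasureTheory.volume : MeasureTheory.Measure ℝ).restrict (Set.Ioc 0 1))
      (auxh_int hT0 hp hpr (hc i) (hc1 i)).1
  have hintv : ∀ i, ∫ U, auxh T p r (c i) (U i) ∂μ ≤
      T * (c i / T) ^ p * (p / (p - 1) + p / (r - p) / r) := by
    intro i
    have h := auxh_int hT0 hp hpr (hc i) (hc1 i)
    rw [hμ, MeasureTheory.integral_comp_eval (μ := fun _ : Fin m =>
      (MeasureTheory.volume : MeasureTheory.Measure ℝ).restrict (Set.Ioc 0 1)) (i := i)
      h.1.aestronglyMeasurable]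
    exact h.2
  have hindI : ∀ j, MeasureTheory.Integrable ((E j).indicator fun _ => z j * w j) μ :=
    fun j => (MeasureTheory.integrable_const _).indicator (hEm j)
  have hRI : MeasureTheory.Integrable
      (fun U : Fin m → ℝ => (C * N z) * (T / q + ∑ i, auxh T p r (c i) (U i))) μ :=
    ((MeasureTheory.integrable_const _).add
      (MeasureTheory.integrable_finsetSum _ fun i _ => hint i)).const_mul _
  have hpos : ∀ᵐ U ∂μ, ∀ i, 0 < U i := by
    rw [MeasureTheory.ae_all_iff]
    intro i
    refine (MeasureTheory.measurePreserving_eval (fun _ : Fin m =>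
      (MeasureTheory.volume : MeasureTheory.Measure ℝ).restrict
        (Set.Ioc 0 1)) i).quasiMeasurePreserving.ae (p := fun u => 0 < u) ?_
    filter_upwards [MeasureTheory.ae_restrict_mem measurableSet_Ioc] with u hu using hu.1
  have hmain : ∫ U, ∑ j, (E j).indicator (fun _ => z j * w j) U ∂μ ≤
      ∫ U, (C * N z) * (T / q + ∑ i, auxh T p r (c i) (U i)) ∂μ := by
    refine MeasureTheory.integral_mono_ae
      (MeasureTheory.integrable_finsetSum _ fun j _ => hindI j) hRI ?_
    filter_upwards [hpos] with U hU
    refine le_trans (le_of_eq ?_) (aux_point hN hunc hq hC hcot z hz hNz hp hrq hT0 c hc φ hφ hφN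
      w hw0 U hU)
    refine Finset.sum_congr rfl fun j _ => ?_
    rw [Set.indicator_apply]
    rfl
  rw [MeasureTheory.integral_finsetSum _ fun j _ => hindI j,
    MeasureTheory.integral_const_mul, MeasureTheory.integral_add (MeasureTheory.integrable_const _)
      (MeasureTheory.integrable_finsetSum _ fun i _ => hint i),
    MeasureTheory.integral_finsetSum _ fun i _ => hint i] at hmain
  simp_rw [fun j => MeasureTheory.integral_indicator_const (μ := μ) (z j * w j) (hEm j)] at hmain
  rw [MeasureTheory.integral_const, MeasureTheory.probReal_univ, one_smul] at hmain
  rw [Finset.mul_sum]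
  refine (Finset.sum_le_sum fun j _ => hE j).trans (hmain.trans ?_)
  have hD0 : 0 ≤ C * N z := (mul_pos (by linarith) hNz).le
  refine mul_le_mul_of_nonneg_left (add_le_add le_rfl ?_) hD0
  refine (Finset.sum_le_sum fun i _ => hintv i).trans ?_
  rw [← Finset.sum_mul, ← Finset.mul_sum]
  have hK : 0 ≤ p / (p - 1) + p / (r - p) / r := by
    have : 0 < p - 1 := by linarith
    have : 0 < r - p := by linarith
    have : 0 < r := by linarith
    positivity
  refine mul_le_mul_of_nonneg_right (mul_le_mul_of_nonneg_left ?_ hT0.le) hK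
  simp_rw [fun i => Real.div_rpow (hc i) hT0.le p]
  rw [← Finset.sum_div]
  exact div_le_div_of_nonneg_right hcs (Real.rpow_nonneg hT0.le _)

lemma aux_final {k m : ℕ} {N : (Fin k → ℝ) → ℝ} (hN : IsNorm k N) (hunc : OneUnconditional k N)
    {q C s : ℝ} (hq : 2 ≤ q) (hC : 1 ≤ C) (hcot : HasCotype k N q C) (hs : q < s)
    (x : Fin m → Fin k → ℝ) (c : Fin m → ℝ) (hc : ∀ i, 0 ≤ c i)
    (hcs : ∑ i, c i ^ (s / (s - 1)) ≤ 1) :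
    (1 - Real.exp (-1)) * ∑ i, N (x i) * c i ≤
      s * (2 * q * (s - 1) / (s - q)) ^ (1 - 1 / s) * C *
        N fun j => (∑ i, |x i j| ^ s) ^ (1 / s) := by
  have hs1 : 0 < s - 1 := by linarith
  have hq1 : 0 < q - 1 := by linarith
  have hsq : 0 < s - q := by linarith
  have hs0 : 0 < s := by linarith
  have hq0 : 0 < q := by linarith
  have he : 0 < 1 - Real.exp (-1) := by
    have : Real.exp (-1) < 1 := by simp
    linarith
  set z : Fin k → ℝ := fun j => (∑ i, |x i j| ^ s) ^ (1 / s) with hzdef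
  have hz : ∀ j, 0 ≤ z j := fun j =>
    Real.rpow_nonneg (Finset.sum_nonneg fun i _ => Real.rpow_nonneg (abs_nonneg _) _) _
  set p := s / (s - 1) with hp
  set r := q / (q - 1) with hr
  set A := 2 * q * (s - 1) / (s - q) with hA
  set T := A ^ (1 - 1 / s) with hT
  have hp1 : 1 < p := by rw [hp, lt_div_iff₀ hs1]; linarith
  have hp0 : 0 < p := by linarith
  have hpr : p < r := by rw [hp, hr, div_lt_div_iff₀ hs1 hq1]; nlinarith
  have hsp : s.HolderConjugate p := Real.HolderConjugate.conjExponent (by linarith)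
  have hqr : q.HolderConjugate r := Real.HolderConjugate.conjExponent (by linarith)
  have hA2 : 2 ≤ A := by rw [hA, le_div_iff₀ hsq]; nlinarith
  have hs11 : 0 ≤ 1 - 1 / s := by
    rw [sub_nonneg, div_le_one hs0]; linarith
  have hT1 : 1 ≤ T := Real.one_le_rpow (by linarith) hs11
  have hTp : T ^ p = A := by
    rw [hT, ← Real.rpow_mul (by linarith), hp, show (1 - 1 / s) * (s / (s - 1)) = 1 by field_simp,
      Real.rpow_one]
  choose φ hφ hφ1 hφN using fun i => aux_functional hN hunc (x i)
  have h1 : ∑ i, N (x i) * c i ≤ ∑ j, z j * (∑ i, (c i * φ i j) ^ p) ^ (1 / p) := by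
    calc ∑ i, N (x i) * c i ≤ ∑ i, (∑ j, φ i j * |x i j|) * c i :=
        Finset.sum_le_sum fun i _ => mul_le_mul_of_nonneg_right (hφ1 i) (hc i)
      _ = ∑ j, ∑ i, |x i j| * (c i * φ i j) := by
        simp_rw [Finset.sum_mul]
        rw [Finset.sum_comm]
        refine Finset.sum_congr rfl fun j _ => Finset.sum_congr rfl fun i _ => ?_
        ring
      _ ≤ _ := Finset.sum_le_sum fun j _ => Real.inner_le_Lp_mul_Lq_of_nonneg _ hsp
        (fun i _ => abs_nonneg _) (fun i _ => mul_nonneg (hc i) (hφ i j))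
  rcases (aux_nonneg hN z).eq_or_lt with h0 | h0
  · rw [← h0, mul_zero]
    have hz0 : z = 0 := (hN.1 z).1 h0.symm
    have : ∑ i, N (x i) * c i ≤ 0 := by simpa [hz0] using h1
    nlinarith
  have h2 := aux_core hN hunc hq hC hcot z hz h0 hp1 hpr hqr.symm hT1 c hc hcs φ hφ hφN
  refine (mul_le_mul_of_nonneg_left h1 he.le).trans (h2.trans ?_)
  rw [hTp]
  have hA0 : 0 < A := by linarith
  have f1 : p / (p - 1) = s := by
    rw [hp]; field_simp; ring
  have f2 : p / (r - p) / r = s * (q - 1) ^ 2 / (q * (s - q)) := by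
    have : r - p = (s - q) / ((q - 1) * (s - 1)) := by
      rw [hp, hr]; field_simp; ring
    rw [this, hp, hr]
    field_simp
  rw [f1, f2]
  have key : 1 / q + 1 / A * (s + s * (q - 1) ^ 2 / (q * (s - q))) ≤ s := by
    have g1 : 1 / A * s ≤ s / 2 := by
      rw [one_div_mul_eq_div]
      exact div_le_div_of_nonneg_left hs0.le (by norm_num) hA2
    have g2 : 1 / A * (s * (q - 1) ^ 2 / (q * (s - q))) ≤ 1 - 1 / q := by
      have : 1 / A * (s * (q - 1) ^ 2 / (q * (s - q))) =
        (1 - 1 / q) * (s * (q - 1) / (2 * q * (s - 1))) := by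
        rw [hA]; field_simp
      rw [this]
      have hq1' : 0 ≤ 1 - 1 / q := by
        rw [sub_nonneg, div_le_one hq0]; linarith
      refine mul_le_of_le_one_right hq1' ?_
      rw [div_le_one (by positivity)]
      nlinarith
    rw [mul_add]
    linarith
  calc C * N z * (T / q + T * (1 / A) * (s + s * (q - 1) ^ 2 / (q * (s - q))))
      = C * N z * T * (1 / q + 1 / A * (s + s * (q - 1) ^ 2 / (q * (s - q)))) := by ring
    _ ≤ C * N z * T * s := by
      refine mul_le_mul_of_nonneg_left key ?_
      positivity
    _ = _ := by ring

/-- Lemma A.4: a `1`-unconditional norm with cotype `q` (constant `C`) is `s`-concave for every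
`s > q`, with the stated constant. -/
theorem stmt_18 {k : ℕ} (hk : 1 ≤ k) (q C : ℝ) (hq : 2 ≤ q) (hC : 1 ≤ C)
    (N : (Fin k → ℝ) → ℝ)
    (hN : IsNorm k N) (hunc : OneUnconditional k N) (hcot : HasCotype k N q C)
    (s : ℝ) (hs : q < s) :
    ∀ (m : ℕ) (x : Fin m → Fin k → ℝ),
      1 / ((1 - Real.exp (-1))⁻¹ ^ 2 * s * (2 * q * (s - 1) / (s - q)) ^ (1 - 1 / s) * C) *
          (∑ i, N (x i) ^ s) ^ (1 / s) ≤
        N fun j => (∑ i, |x i j| ^ s) ^ (1 / s) := by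
  intro m x
  have he : 0 < 1 - Real.exp (-1) := by
    have : Real.exp (-1) < 1 := by simp
    linarith
  have he1 : 1 - Real.exp (-1) ≤ 1 := by
    have := Real.exp_pos (-1); linarith
  have hs1 : 0 < s - 1 := by linarith
  have hsq : 0 < s - q := by linarith
  have hs0 : 0 < s := by linarith
  have hq0 : 0 < q := by linarith
  have hsp : s.HolderConjugate (s / (s - 1)) := Real.HolderConjugate.conjExponent (by linarith)
  let f : Fin m → NNReal := fun i => ⟨N (x i), aux_nonneg hN _⟩
  obtain ⟨g, hg1, hg2⟩ := (NNReal.isGreatest_Lp Finset.univ f hsp).1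
  have hg1' : ∑ i, (g i : ℝ) ^ (s / (s - 1)) ≤ 1 := by
    have : ∑ i, g i ^ (s / (s - 1)) ≤ 1 := hg1
    exact_mod_cast this
  have hg2' : ∑ i, N (x i) * (g i : ℝ) = (∑ i, N (x i) ^ s) ^ (1 / s) := by
    have := congrArg (fun t : NNReal => (t : ℝ)) hg2
    push_cast at this
    exact this
  have h := aux_final hN hunc hq hC hcot hs x (fun i => g i) (fun i => (g i).2) hg1'
  rw [hg2'] at h
  set K := s * (2 * q * (s - 1) / (s - q)) ^ (1 - 1 / s) * C with hK
  set Z := N fun j => (∑ i, |x i j| ^ s) ^ (1 / s) with hZ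
  have hZ0 : 0 ≤ Z := aux_nonneg hN _
  have hB : 0 < (2 * q * (s - 1) / (s - q)) ^ (1 - 1 / s) :=
    Real.rpow_pos_of_pos (by positivity) _
  have hK0 : 0 < K := by positivity
  have hS : 0 ≤ (∑ i, N (x i) ^ s) ^ (1 / s) := 
    Real.rpow_nonneg (Finset.sum_nonneg fun i _ => Real.rpow_nonneg (aux_nonneg hN _) _) _
  set S := (∑ i, N (x i) ^ s) ^ (1 / s)
  have : (1 - Real.exp (-1))⁻¹ ^ 2 * s * (2 * q * (s - 1) / (s - q)) ^ (1 - 1 / s) * C =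
      K / (1 - Real.exp (-1)) ^ 2 := by
    rw [hK]; field_simp
  rw [this, one_div_div, div_mul_eq_mul_div, div_le_iff₀ hK0]
  calc (1 - Real.exp (-1)) ^ 2 * S ≤ (1 - Real.exp (-1)) * S := by
        refine mul_le_mul_of_nonneg_right ?_ hS
        nlinarith
    _ ≤ K * Z := h
    _ = Z * K := mul_comm _ _
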